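/- Assume ⊢^R is contrapositive for assumptions. If φ ∈ CN(S ∪ T) for every T ∈ MCS(S,A), then every preferred extension of the sequent-based ABA-framework contains some argument whose conclusion is φ. -/

import Mathlib

/-- A rule `φ₁,…,φₙ → φ` of a deductive system: premises and a conclusion. -/
abbrev Rule (F : Type) := List F × F

/-- Deducibility `Γ ⊢^R φ`: chaining rules of `R` from members of `Γ`. -/
inductive Ded {F : Type} (R : Set (Rule F)) (Γ : Set F) : F → Prop
  | mem {φ : F} : φ ∈ Γ → Ded R Γ φ
  | app {l : List F} {φ : F} : (l, φ) ∈ R → (∀ ψ ∈ l, Ded R Γ ψ) → Ded R Γ φ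

/-- Derivability of assumptive sequents `A' ⟨ Γ ⇒ Δ` in the calculus `R_⇒`:
the sequents `μ(r)` for `r ∈ R`, the identity axiom, the two cut rules, and the
rules `AS_ABA` moving a formula of the assumption set `AS` between the
assumption component and the left-hand side of `⇒`. -/
inductive SeqDer {F : Type} [DecidableEq F] (R : Set (Rule F)) (AS : Set F) :
    Finset F → Finset F → Finset F → Prop
  | id (φ : F) : SeqDer R AS ∅ {φ} {φ}
  | mu {l : List F} {φ : F} : (l, φ) ∈ R → SeqDer R AS ∅ l.toFinset {φ}
  | cutLhs {A₁ A₂ Γ₁ Γ₂ Δ₁ Δ₂ : Finset F} {φ : F} :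
      SeqDer R AS A₁ Γ₁ (insert φ Δ₁) → SeqDer R AS A₂ (insert φ Γ₂) Δ₂ →
      SeqDer R AS (A₁ ∪ A₂) (Γ₁ ∪ Γ₂) (Δ₁ ∪ Δ₂)
  | cutAss {A₁ A₂ Γ₁ Γ₂ Δ₁ Δ₂ : Finset F} {φ : F} :
      SeqDer R AS A₁ Γ₁ (insert φ Δ₁) → SeqDer R AS (insert φ A₂) Γ₂ Δ₂ →
      SeqDer R AS (A₁ ∪ A₂) (Γ₁ ∪ Γ₂) (Δ₁ ∪ Δ₂)
  | toAss {A' Γ Δ : Finset F} {φ : F} :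
      φ ∈ AS → SeqDer R AS A' (insert φ Γ) Δ → SeqDer R AS (insert φ A') Γ Δ
  | toLhs {A' Γ Δ : Finset F} {φ : F} :
      φ ∈ AS → SeqDer R AS (insert φ A') Γ Δ → SeqDer R AS A' (insert φ Γ) Δ

/-- An argument: an assumption component, a support (strict premises) and a conclusion. -/
structure Argu (F : Type) where
  ass : Finset F
  supp : Finset F
  concl : F

/-- `a` is an ABA-argument based on `S` and `A`: a deduction `ass(a) ∪ supp(a) ⊢^R conc(a)`
with finite `ass(a) ⊆ A` and finite `supp(a) ⊆ S`. -/
def IsABAArg {F : Type} (R : Set (Rule F)) (S A : Set F) (a : Argu F) : Prop :=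
  ↑a.ass ⊆ A ∧ ↑a.supp ⊆ S ∧ Ded R (↑a.ass ∪ ↑a.supp) a.concl

/-- `a` is an assumptive sequent argument based on `S` and `A`: a sequent
`ass(a) ⟨ supp(a) ⇒ conc(a)` derivable in `R_⇒`, with `ass(a) ⊆ A` and `supp(a) ⊆ S`. -/
def IsSeqArg {F : Type} [DecidableEq F] (R : Set (Rule F)) (S A : Set F) (a : Argu F) : Prop :=
  ↑a.ass ⊆ A ∧ ↑a.supp ⊆ S ∧ SeqDer R A a.ass a.supp {a.concl}

/-- `a` attacks `b` iff the conclusion of `a` is the contrary of some assumption of `b`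
(this is the ABA attack, and also the sequent-based `AT_ABA` attack). -/
def Attacks {F : Type} (contrary : F → F) (a b : Argu F) : Prop :=
  ∃ ψ ∈ b.ass, a.concl = contrary ψ

/-- `E` is conflict-free: a set of arguments of the framework no member of which attacks a member. -/
def ConflictFree {α : Type} (Args : Set α) (att : α → α → Prop) (E : Set α) : Prop :=
  E ⊆ Args ∧ ∀ a ∈ E, ∀ b ∈ E, ¬ att a b

/-- `E` defends `a`: `E` attacks every attacker of `a`. -/
def Defends {α : Type} (Args : Set α) (att : α → α → Prop) (E : Set α) (a : α) : Prop :=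
  ∀ b ∈ Args, att b a → ∃ c ∈ E, att c b

/-- `E` is admissible: conflict-free and defending all of its elements. -/
def Admissible {α : Type} (Args : Set α) (att : α → α → Prop) (E : Set α) : Prop :=
  ConflictFree Args att E ∧ ∀ a ∈ E, Defends Args att E a

/-- A complete extension: an admissible set containing every argument it defends. -/
def CompleteExt {α : Type} (Args : Set α) (att : α → α → Prop) (E : Set α) : Prop :=
  Admissible Args att E ∧ ∀ a ∈ Args, Defends Args att E a → a ∈ E

/-- The grounded extension: the ⊆-minimal complete extension. -/
def GroundedExt {α : Type} (Args : Set α) (att : α → α → Prop) (E : Set α) : Prop :=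
  CompleteExt Args att E ∧ ∀ E', CompleteExt Args att E' → E ⊆ E'

/-- A preferred extension: a ⊆-maximal complete extension. -/
def PreferredExt {α : Type} (Args : Set α) (att : α → α → Prop) (E : Set α) : Prop :=
  CompleteExt Args att E ∧ ∀ E', CompleteExt Args att E' → E ⊆ E' → E' = E

/-- A set `A'` of assumptions is consistent iff there is no `φ ∈ A'` with
`A'' ∪ Γ ⊢^R φ̄` for some `A'' ⊆ A'` and `Γ ⊆ S`. -/
def ConsistentSet {F : Type} (R : Set (Rule F)) (contrary : F → F) (S : Set F)
    (A' : Set F) : Prop :=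
  ¬ ∃ φ ∈ A', ∃ A'' ⊆ A', ∃ Γ ⊆ S, Ded R (A'' ∪ Γ) (contrary φ)

/-- `MCS(S,A)`: the set of ⊆-maximal consistent subsets of `A`. -/
def MCS {F : Type} (R : Set (Rule F)) (contrary : F → F) (S A : Set F) : Set (Set F) :=
  {T | T ⊆ A ∧ ConsistentSet R contrary S T ∧
    ∀ T', T ⊆ T' → T' ⊆ A → ConsistentSet R contrary S T' → T' = T}

/-- `CN(T) = {φ | Γ ⊢^R φ for some Γ ⊆ T}`. -/
def CN {F : Type} (R : Set (Rule F)) (T : Set F) : Set F :=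
  {φ | ∃ Γ ⊆ T, Ded R Γ φ}

/-- `⊢^R` is contrapositive for assumptions: for all `φ, ψ` in an assumption set `A'`
and `Γ ⊆ S`, `A' ∪ Γ ⊢^R ψ̄` iff `(A' \ {φ}) ∪ {ψ} ∪ Γ ⊢^R φ̄`. -/
def Contrapositive {F : Type} (R : Set (Rule F)) (contrary : F → F) (S A : Set F) : Prop :=
  ∀ A' ⊆ A, ∀ Γ ⊆ S, ∀ φ ∈ A', ∀ ψ ∈ A',
    (Ded R (A' ∪ Γ) (contrary ψ) ↔ Ded R ((A' \ {φ}) ∪ {ψ} ∪ Γ) (contrary φ))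

/-- Deducibility is monotone in the set of premises. -/
theorem Ded.mono {F : Type} {R : Set (Rule F)} {Γ Γ' : Set F} {φ : F} (hΓ : Γ ⊆ Γ')
    (h : Ded R Γ φ) : Ded R Γ' φ := by
  induction h with
  | mem h => exact .mem (hΓ h)
  | app hr _ ih => exact .app hr ih

/-- Deducibility is closed under cut. -/
theorem Ded.cut {F : Type} {R : Set (Rule F)} {Γ Γ' : Set F} {φ : F} (h : Ded R Γ φ)
    (hΓ : ∀ ψ ∈ Γ, Ded R Γ' ψ) : Ded R Γ' φ := by
  induction h with
  | mem h => exact hΓ _ h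
  | app hr _ ih => exact .app hr ih

/-- The calculus `R_⇒` is sound: every formula on the right of a derivable sequent is deducible
from the assumptions and the support together. -/
theorem SeqDer.ded {F : Type} [DecidableEq F] {R : Set (Rule F)} {AS : Set F}
    {A Γ Δ : Finset F} (h : SeqDer R AS A Γ Δ) : ∀ δ ∈ Δ, Ded R (↑A ∪ ↑Γ) δ := by
  induction h with
  | id φ => exact fun δ hδ => .mem (by simpa using hδ)
  | mu hr =>
    intro δ hδ
    obtain rfl := Finset.mem_singleton.1 hδ
    exact .app hr fun ψ hψ => .mem (by simpa using hψ)
  | @cutLhs A₁ A₂ Γ₁ Γ₂ Δ₁ Δ₂ φ _ _ ih₁ ih₂ =>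
    intro δ hδ
    have hsub : (↑A₁ ∪ ↑Γ₁ : Set F) ⊆ ↑(A₁ ∪ A₂) ∪ ↑(Γ₁ ∪ Γ₂) := by
      intro x; simp; tauto
    rcases Finset.mem_union.1 hδ with hδ | hδ
    · exact (ih₁ δ (Finset.mem_insert_of_mem hδ)).mono hsub
    · refine (ih₂ δ hδ).cut fun ψ hψ => ?_
      by_cases hφ : ψ = φ
      · exact hφ ▸ (ih₁ φ (Finset.mem_insert_self _ _)).mono hsub
      · refine .mem ?_
        simp [hφ] at hψ ⊢; tauto
  | @cutAss A₁ A₂ Γ₁ Γ₂ Δ₁ Δ₂ φ _ _ ih₁ ih₂ =>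
    intro δ hδ
    have hsub : (↑A₁ ∪ ↑Γ₁ : Set F) ⊆ ↑(A₁ ∪ A₂) ∪ ↑(Γ₁ ∪ Γ₂) := by
      intro x; simp; tauto
    rcases Finset.mem_union.1 hδ with hδ | hδ
    · exact (ih₁ δ (Finset.mem_insert_of_mem hδ)).mono hsub
    · refine (ih₂ δ hδ).cut fun ψ hψ => ?_
      by_cases hφ : ψ = φ
      · exact hφ ▸ (ih₁ φ (Finset.mem_insert_self _ _)).mono hsub
      · refine .mem ?_
        simp [hφ] at hψ ⊢; tauto
  | toAss _ _ ih => exact fun δ hδ => (ih δ hδ).mono (by intro x; simp; tauto)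
  | toLhs _ _ ih => exact fun δ hδ => (ih δ hδ).mono (by intro x; simp; tauto)

/-- Formulas of the left-hand side that are derivable from supports in `Γ` can be cut away. -/
theorem SeqDer.exists_cut {F : Type} [DecidableEq F] {R : Set (Rule F)} {AS Γ : Set F} {φ : F}
    (L : Finset F) (hL : ∀ ψ ∈ L, ∃ G : Finset F, ↑G ⊆ Γ ∧ SeqDer R AS ∅ G {ψ}) :
    ∀ G : Finset F, ↑G ⊆ Γ → SeqDer R AS ∅ (L ∪ G) {φ} →
      ∃ G' : Finset F, ↑G' ⊆ Γ ∧ SeqDer R AS ∅ G' {φ} := by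
  induction L using Finset.induction_on with
  | empty => exact fun G hG h => ⟨G, hG, by simpa using h⟩
  | insert ψ L _ ih =>
    intro G hG h
    obtain ⟨Gψ, hGψ, hψ⟩ := hL ψ (Finset.mem_insert_self _ _)
    refine ih (fun χ hχ => hL χ (Finset.mem_insert_of_mem hχ)) (Gψ ∪ G) (by simp [hGψ, hG]) ?_
    rw [Finset.insert_union] at h
    have hcut := SeqDer.cutLhs (Δ₁ := ∅) (by simpa using hψ) h
    simpa [Finset.union_left_comm] using hcut

/-- The calculus `R_⇒` is complete: a formula deducible from `Γ` is the conclusion of a derivable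
sequent with finite support in `Γ` and no assumptions. -/
theorem Ded.exists_seqDer {F : Type} [DecidableEq F] {R : Set (Rule F)} (AS : Set F) {Γ : Set F}
    {φ : F} (h : Ded R Γ φ) : ∃ G : Finset F, ↑G ⊆ Γ ∧ SeqDer R AS ∅ G {φ} := by
  induction h with
  | @mem φ h => exact ⟨{φ}, by simpa using h, .id φ⟩
  | @app l φ hr _ ih =>
    exact SeqDer.exists_cut l.toFinset (fun ψ hψ => ih ψ (by simpa using hψ)) ∅ (by simp)
      (by simpa using SeqDer.mu hr)

/-- A set of assumptions can be moved from the left-hand side to the assumption component. -/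
theorem SeqDer.union_toAss {F : Type} [DecidableEq F] {R : Set (Rule F)} {AS : Set F}
    {G Δ : Finset F} (B : Finset F) (hB : ↑B ⊆ AS) :
    ∀ A' : Finset F, SeqDer R AS A' (B ∪ G) Δ → SeqDer R AS (B ∪ A') G Δ := by
  induction B using Finset.induction_on with
  | empty => exact fun A' h => by simpa using h
  | insert ψ B _ ih =>
    intro A' h
    rw [Finset.coe_insert, Set.insert_subset_iff] at hB
    rw [Finset.insert_union] at h
    simpa [Finset.insert_union, Finset.union_insert] using ih hB.2 _ (h.toAss hB.1)

/-- The conclusion of a sequent argument is deducible from its assumptions and the strict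
premises. -/
theorem IsSeqArg.ded {F : Type} [DecidableEq F] {R : Set (Rule F)} {S A : Set F} {a : Argu F}
    (ha : IsSeqArg R S A a) : Ded R (↑a.ass ∪ S) a.concl :=
  (ha.2.2.ded _ (Finset.mem_singleton_self _)).mono (Set.union_subset_union_right _ ha.2.1)

/-- Every formula deducible from assumptions in `T` and strict premises is the conclusion of a
sequent argument whose assumptions lie in `T`. -/
theorem Ded.exists_isSeqArg {F : Type} [DecidableEq F] {R : Set (Rule F)} {S A T : Set F} {φ : F}
    (hT : T ⊆ A) (h : Ded R (T ∪ S) φ) :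
    ∃ a : Argu F, IsSeqArg R S A a ∧ ↑a.ass ⊆ T ∧ a.concl = φ := by
  classical
  obtain ⟨G, hG, hd⟩ := h.exists_seqDer A
  have hass : (↑(G.filter (· ∈ T)) : Set F) ⊆ T := fun x hx => (Finset.mem_filter.1 hx).2
  refine ⟨⟨G.filter (· ∈ T), G.filter (· ∉ T), φ⟩, ⟨hass.trans hT, fun x hx => ?_, ?_⟩, hass, rfl⟩
  · obtain ⟨hxG, hxT⟩ := Finset.mem_filter.1 hx
    exact (hG hxG).resolve_left hxT
  · rw [← Finset.filter_union_filter_not_eq (· ∈ T) G] at hd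
    simpa using SeqDer.union_toAss _ (hass.trans hT) ∅ hd

/-- A set of assumptions is consistent iff, with the strict premises, it deduces no contrary of a
member. -/
theorem consistentSet_iff {F : Type} {R : Set (Rule F)} {contrary : F → F} {S T : Set F} :
    ConsistentSet R contrary S T ↔ ∀ ψ ∈ T, ¬ Ded R (T ∪ S) (contrary ψ) := by
  refine ⟨fun h ψ hψ hd => h ⟨ψ, hψ, T, subset_rfl, S, subset_rfl, hd⟩, ?_⟩
  rintro h ⟨ψ, hψ, T', hT', Γ, hΓ, hd⟩
  exact h ψ hψ (hd.mono (Set.union_subset_union hT' hΓ))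

/-- Every consistent set of assumptions extends to a maximal consistent one. -/
theorem ConsistentSet.exists_mcs {F : Type} [DecidableEq F] {R : Set (Rule F)}
    {contrary : F → F} {S A T : Set F} (hTA : T ⊆ A) (hT : ConsistentSet R contrary S T) :
    ∃ M ∈ MCS R contrary S A, T ⊆ M := by
  obtain ⟨M, hTM, hM⟩ := zorn_subset_nonempty
    {T : Set F | T ⊆ A ∧ ConsistentSet R contrary S T} (fun c hc hchain hne => by
      have hcA : ⋃₀ c ⊆ A := Set.sUnion_subset fun U hU => (hc hU).1
      refine ⟨⋃₀ c, ⟨hcA, consistentSet_iff.2 fun ψ ⟨U, hU, hψ⟩ hd => ?_⟩,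
        fun U hU => Set.subset_sUnion_of_mem hU⟩
      obtain ⟨a, ha, hac, hconcl⟩ := hd.exists_isSeqArg hcA
      obtain ⟨W, hW, haW⟩ := hchain.directedOn.exists_mem_subset_of_finset_subset_biUnion
        (f := _root_.id) hne (s := a.ass) (by simpa [Set.sUnion_eq_biUnion] using hac)
      have hded := hconcl ▸ ha.ded
      rcases hchain.total hU hW with hUW | hWU
      · exact consistentSet_iff.1 (hc hW).2 ψ (hUW hψ)
          (hded.mono (Set.union_subset_union_left _ haW))
      · exact consistentSet_iff.1 (hc hU).2 ψ hψ
          (hded.mono (Set.union_subset_union_left _ (haW.trans hWU)))) T ⟨hTA, hT⟩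
  exact ⟨M, ⟨hM.prop.1, hM.prop.2, fun T' hMT' hT'A hT' =>
    (hM.le_of_ge ⟨hT'A, hT'⟩ hMT').antisymm hMT'⟩, hTM⟩

/-- The sequent arguments whose assumptions lie in `T`. -/
def argsOver {F : Type} [DecidableEq F] (R : Set (Rule F)) (S A T : Set F) : Set (Argu F) :=
  {a | IsSeqArg R S A a ∧ ↑a.ass ⊆ T}

/-- Adding an outside assumption `b` to a maximal consistent set makes the contrary of `b`
deducible. -/
theorem ded_contrary_of_notMem_mcs {F : Type} {R : Set (Rule F)} {contrary : F → F}
    {S A T : Set F} (hcp : Contrapositive R contrary S A) (hT : T ∈ MCS R contrary S A)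
    {b : F} (hbA : b ∈ A) (hb : b ∉ T) : Ded R (insert b T ∪ S) (contrary b) := by
  have hsub : insert b T ⊆ A := Set.insert_subset hbA hT.1
  have hnot : ¬ ConsistentSet R contrary S (insert b T) := fun hc =>
    hb (hT.2.2 _ (Set.subset_insert _ _) hsub hc ▸ Set.mem_insert b T)
  simp only [consistentSet_iff, not_forall, not_not] at hnot
  obtain ⟨χ, hχ, hd⟩ := hnot
  refine ((hcp _ hsub S subset_rfl b (Set.mem_insert _ _) χ hχ).1 hd).mono
    (Set.union_subset_union_left _ (Set.union_subset Set.sdiff_subset (by simpa using hχ)))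

/-- By contraposition, a nonempty maximal consistent set deduces the contrary of every assumption
outside it. -/
theorem mcs_ded_contrary_of_notMem {F : Type} {R : Set (Rule F)} {contrary : F → F}
    {S A T : Set F} (hcp : Contrapositive R contrary S A) (hT : T ∈ MCS R contrary S A)
    {b ψ : F} (hbA : b ∈ A) (hb : b ∉ T) (hψ : ψ ∈ T) : Ded R (T ∪ S) (contrary b) := by
  have hsub : insert b T ⊆ A := Set.insert_subset hbA hT.1
  have hψ' : ψ ∈ insert b T := Set.mem_insert_of_mem _ hψ
  have hdψ : Ded R (insert b T ∪ S) (contrary ψ) :=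
    ((hcp _ hsub S subset_rfl ψ hψ' b (Set.mem_insert _ _)).1
      (ded_contrary_of_notMem_mcs hcp hT hbA hb)).mono
      (Set.union_subset_union_left _ (Set.union_subset Set.sdiff_subset (by simp)))
  refine ((hcp _ hsub S subset_rfl b (Set.mem_insert _ _) ψ hψ').1 hdψ).mono
    (Set.union_subset_union_left _ (Set.union_subset ?_ (by simpa using hψ)))
  simp

/-- The arguments over a maximal consistent set form a complete extension. -/
theorem completeExt_argsOver {F : Type} [DecidableEq F] {R : Set (Rule F)} {contrary : F → F}
    {S A T : Set F} (hcp : Contrapositive R contrary S A) (hT : T ∈ MCS R contrary S A) :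
    CompleteExt {a | IsSeqArg R S A a} (Attacks contrary) (argsOver R S A T) := by
  have hcons := consistentSet_iff.1 hT.2.1
  have hcf : ∀ a ∈ argsOver R S A T, ∀ ψ ∈ T, a.concl ≠ contrary ψ := fun a ha ψ hψ heq =>
    hcons ψ hψ (heq ▸ ha.1.ded.mono (Set.union_subset_union_left _ ha.2))
  refine ⟨⟨⟨fun a ha => ha.1, fun a ha b hb ⟨ψ, hψ, heq⟩ => hcf a ha ψ (hb.2 hψ) heq⟩, ?_⟩, ?_⟩
  · rintro a ha b hb ⟨ψ, hψ, heq⟩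
    have hbT : ¬ (↑b.ass : Set F) ⊆ T := fun hbT => hcf b ⟨hb, hbT⟩ ψ (ha.2 hψ) heq
    obtain ⟨χ, hχ, hχT⟩ := Set.not_subset.1 hbT
    obtain ⟨c, hc, hcT, hconcl⟩ :=
      (mcs_ded_contrary_of_notMem hcp hT (hb.1 hχ) hχT (ha.2 hψ)).exists_isSeqArg hT.1
    exact ⟨c, ⟨hc, hcT⟩, χ, hχ, hconcl⟩
  · refine fun a ha hdef => ⟨ha, fun b hb => ?_⟩
    by_contra hbT
    have hbA := ha.1 hb
    obtain ⟨c, hc, hcT, hconcl⟩ := (ded_contrary_of_notMem_mcs hcp hT hbA hbT).exists_isSeqArg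
      (Set.insert_subset hbA hT.1)
    obtain ⟨d, hd, χ, hχ, hdχ⟩ := hdef c hc ⟨b, hb, hconcl⟩
    rcases hcT hχ with rfl | hχT
    · obtain ⟨e, he, ξ, hξ, heξ⟩ := hdef d hd.1 ⟨χ, hb, hdχ⟩
      exact hcf e he ξ (hd.2 hξ) heξ
    · exact hcf d hd χ hχT hdχ

/-- A complete extension consists of arguments over some consistent set of assumptions. -/
theorem CompleteExt.exists_consistentSet {F : Type} [DecidableEq F] {R : Set (Rule F)}
    {contrary : F → F} {S A : Set F} {E : Set (Argu F)}
    (hE : CompleteExt {a | IsSeqArg R S A a} (Attacks contrary) E) :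
    ∃ T ⊆ A, ConsistentSet R contrary S T ∧ E ⊆ argsOver R S A T := by
  obtain ⟨⟨⟨hEargs, hcf⟩, hdef⟩, hcomp⟩ := hE
  have hTA : {ψ | ∃ a ∈ E, ψ ∈ a.ass} ⊆ A := fun ψ ⟨a, ha, hψ⟩ => (hEargs ha).1 hψ
  refine ⟨_, hTA, consistentSet_iff.2 fun ψ ⟨a, ha, hψ⟩ hd => ?_,
    fun a ha => ⟨hEargs ha, fun ψ hψ => ⟨a, ha, hψ⟩⟩⟩
  obtain ⟨b, hb, hbT, hconcl⟩ := hd.exists_isSeqArg hTA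
  refine hcf b (hcomp b hb fun c hc ⟨χ, hχ, hcχ⟩ => ?_) a ha ⟨ψ, hψ, hconcl⟩
  obtain ⟨e, he, hχe⟩ := hbT hχ
  exact hdef e he c hc ⟨χ, hχe, hcχ⟩

/-- Assuming `⊢^R` is contrapositive for assumptions: if `φ ∈ CN(S ∪ T)` for every
`T ∈ MCS(S,A)`, then every preferred extension of the sequent-based ABA-framework
contains some argument whose conclusion is `φ`. -/
theorem stmt18 {F V : Type} [DecidableEq F]
    (R : Set (Rule F)) (S A : Set F) (contrary : F → F) (atoms : F → Set V)
    (hA : A.Nonempty) (hSA : S ∩ A = ∅)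
    (hNT : ∀ φ : F, (∀ s ∈ S, Disjoint (atoms φ) (atoms s)) → ¬ Ded R S φ)
    (hcp : Contrapositive R contrary S A) (φ : F)
    (h : ∀ T ∈ MCS R contrary S A, φ ∈ CN R (S ∪ T)) :
    ∀ E, PreferredExt {a | IsSeqArg R S A a} (Attacks contrary) E →
      ∃ a ∈ E, a.concl = φ := by
  intro E hE
  obtain ⟨T₀, hT₀A, hT₀, hET₀⟩ := hE.1.exists_consistentSet
  obtain ⟨T, hT, hT₀T⟩ := hT₀.exists_mcs hT₀A
  have hEq : argsOver R S A T = E := hE.2 _ (completeExt_argsOver hcp hT) fun a ha =>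
    ⟨(hET₀ ha).1, (hET₀ ha).2.trans hT₀T⟩
  obtain ⟨Γ, hΓ, hd⟩ := h T hT
  obtain ⟨a, ha, haT, hconcl⟩ :=
    (hd.mono (hΓ.trans (Set.union_comm S T).subset)).exists_isSeqArg hT.1
  exact ⟨a, hEq ▸ ⟨ha, haT⟩, hconcl⟩
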